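/- (Lemma 3.9) The shift decoration commutes with linear negation: for every unpolarized formula A, ⌊A⌋⊥ = ⌊A⊥⌋. -/

import Mathlib

/-- Unpolarized formulas of LG/CNL.  `ldiv B A` denotes `B\A`, `lsub B A` denotes `B⦸A`,
`rdiv A B` denotes `A/B`, `rsub A B` denotes `A⊘B`. -/
inductive Fm : Type
  | pos : Nat → Fm                -- positive atom p
  | neg : Nat → Fm                -- negative atom p̄
  | tens : Fm → Fm → Fm           -- A ⊗ B
  | par : Fm → Fm → Fm            -- A ⊕ B
  | rdiv : Fm → Fm → Fm           -- A / B
  | ldiv : Fm → Fm → Fm           -- B \ A  (ldiv B A)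
  | rsub : Fm → Fm → Fm           -- A ⊘ B
  | lsub : Fm → Fm → Fm           -- B ⦸ A  (lsub B A)
  | conj : Fm → Fm → Fm           -- A ∧ B
  | disj : Fm → Fm → Fm           -- A ∨ B

/-- Linear negation. -/
def Fm.dual : Fm → Fm
  | .pos n => .neg n
  | .neg n => .pos n
  | .tens A B => .par B.dual A.dual        -- (A⊗B)⊥ = B⊥⊕A⊥
  | .par A B => .tens B.dual A.dual        -- (A⊕B)⊥ = B⊥⊗A⊥
  | .rdiv A B => .lsub B.dual A.dual       -- (A/B)⊥ = B⊥⦸A⊥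
  | .lsub B A => .rdiv A.dual B.dual       -- (B⦸A)⊥ = A⊥/B⊥
  | .ldiv B A => .rsub A.dual B.dual       -- (B\A)⊥ = A⊥⊘B⊥
  | .rsub A B => .ldiv B.dual A.dual       -- (A⊘B)⊥ = B⊥\A⊥
  | .conj A B => .disj B.dual A.dual       -- (A∧B)⊥ = B⊥∨A⊥
  | .disj A B => .conj B.dual A.dual       -- (A∨B)⊥ = B⊥∧A⊥
mutual
/-- Positive polarized formulas.  `rsub P N` denotes `P⊘N`, `lsub N P` denotes `N⦸P`. -/
inductive PFm : Type
  | pos : Nat → PFm               -- atom p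
  | tens : PFm → PFm → PFm        -- P ⊗ Q
  | rsub : PFm → NFm → PFm        -- P ⊘ N
  | lsub : NFm → PFm → PFm        -- N ⦸ P
  | disj : PFm → PFm → PFm        -- P ∨ Q
  | down : NFm → PFm              -- ↓N
/-- Negative polarized formulas.  `rdiv M Q` denotes `M/Q`, `ldiv Q M` denotes `Q\M`. -/
inductive NFm : Type
  | neg : Nat → NFm               -- atom p̄
  | par : NFm → NFm → NFm         -- M ⊕ N
  | ldiv : PFm → NFm → NFm        -- Q \ M
  | rdiv : NFm → PFm → NFm        -- M / Q
  | conj : NFm → NFm → NFm        -- M ∧ N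
  | up : PFm → NFm                -- ↑P
end

mutual
/-- Polarized linear negation (positive to negative). -/
def PFm.dual : PFm → NFm
  | .pos n => .neg n
  | .tens P Q => .par Q.dual P.dual        -- (P⊗Q)⊥ = Q⊥⊕P⊥
  | .rsub P N => .ldiv N.dual P.dual       -- (P⊘N)⊥ = N⊥\P⊥
  | .lsub N P => .rdiv P.dual N.dual       -- (N⦸P)⊥ = P⊥/N⊥
  | .disj P Q => .conj Q.dual P.dual       -- (P∨Q)⊥ = Q⊥∧P⊥
  | .down N => .up N.dual                  -- (↓N)⊥ = ↑(N⊥)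
/-- Polarized linear negation (negative to positive). -/
def NFm.dual : NFm → PFm
  | .neg n => .pos n
  | .par M N => .tens N.dual M.dual        -- (M⊕N)⊥ = N⊥⊗M⊥
  | .ldiv Q M => .rsub M.dual Q.dual       -- (Q\M)⊥ = M⊥⊘Q⊥
  | .rdiv M Q => .lsub Q.dual M.dual       -- (M/Q)⊥ = Q⊥⦸M⊥
  | .conj M N => .disj N.dual M.dual       -- (M∧N)⊥ = N⊥∨M⊥
  | .up P => .down P.dual                  -- (↑P)⊥ = ↓(P⊥)
end
/-- The polarity ε of an unpolarized formula: `true` (positive) for `p`, `⊗`, `⊘`, `⦸`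
(and the additive disjunction `∨`, which decorates to a positive polarized formula),
`false` (negative) otherwise. -/
def Fm.eps : Fm → Bool
  | .pos _ => true
  | .tens _ _ => true
  | .rsub _ _ => true
  | .lsub _ _ => true
  | .disj _ _ => true
  | _ => false

mutual
/-- `decP A` is `A'`: the shift decoration `⌊A⌋` if `ε(A)=+`, and `↓⌊A⌋` if `ε(A)=−`.
In particular, for positive `A`, `⌊A⌋ = decP A`. -/
def decP : Fm → PFm
  | .pos n => .pos n
  | .neg n => .down (.neg n)
  | .tens A B => .tens (decP A) (decP B)           -- ⌊A⊗B⌋ = A'⊗B'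
  | .rsub A B => .rsub (decP A) (decN B)           -- ⌊A⊘B⌋ = A'⊘B''
  | .lsub B A => .lsub (decN B) (decP A)           -- ⌊B⦸A⌋ = B''⦸A'
  | .disj A B => .disj (decP A) (decP B)           -- ⌊A∨B⌋ = A'∨B'
  | .par A B => .down (.par (decN A) (decN B))     -- ⌊A⊕B⌋ = A''⊕B''
  | .ldiv B A => .down (.ldiv (decP B) (decN A))   -- ⌊B\A⌋ = B'\A''
  | .rdiv A B => .down (.rdiv (decN A) (decP B))   -- ⌊A/B⌋ = A''/B'
  | .conj A B => .down (.conj (decN A) (decN B))   -- ⌊A∧B⌋ = A''∧B''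
/-- `decN A` is `A''`: the shift decoration `⌊A⌋` if `ε(A)=−`, and `↑⌊A⌋` if `ε(A)=+`.
In particular, for negative `A`, `⌊A⌋ = decN A`. -/
def decN : Fm → NFm
  | .pos n => .up (.pos n)
  | .neg n => .neg n
  | .tens A B => .up (.tens (decP A) (decP B))
  | .rsub A B => .up (.rsub (decP A) (decN B))
  | .lsub B A => .up (.lsub (decN B) (decP A))
  | .disj A B => .up (.disj (decP A) (decP B))
  | .par A B => .par (decN A) (decN B)
  | .ldiv B A => .ldiv (decP B) (decN A)
  | .rdiv A B => .rdiv (decN A) (decP B)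
  | .conj A B => .conj (decN A) (decN B)
end

theorem dec_dual_aux (A : Fm) :
    (decP A).dual = decN A.dual ∧ (decN A).dual = decP A.dual := by
  induction A <;> simp_all [decP, decN, Fm.dual, PFm.dual, NFm.dual]

/-- Lemma 3.9: the shift decoration commutes with linear negation:
⌊A⌋⊥ = ⌊A⊥⌋.  Here ⌊A⌋ is `decP A` when ε(A)=+ (and then ⌊A⊥⌋ = `decN A⊥`, as
ε(A⊥)=−), and ⌊A⌋ is `decN A` when ε(A)=− (and then ⌊A⊥⌋ = `decP A⊥`). -/
theorem dec_dual (A : Fm) :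
    (A.eps = true → (decP A).dual = decN A.dual) ∧
    (A.eps = false → (decN A).dual = decP A.dual) := by
  exact ⟨fun _ => (dec_dual_aux A).1, fun _ => (dec_dual_aux A).2⟩
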